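/- arXiv:2603.06033 — 2 statements merged into one kernel-verified Lean document; each statement's English description precedes it below -/
import Mathlib

section
/- Let g ≥ 5 be odd and set m = (g+1)/2. Define a symmetric bilinear form on k^{g−1} (coordinates indexed 1, …, g−1) by {x, y} = x_1·y_1 + x_m·y_m + ∑_{2 ≤ i ≤ g−1, i ≠ m} x_i·y_{g+1−i}. Let v ∈ k^{g−1} and suppose {v, σ^j(v)} = 0 for every odd j with 1 ≤ j ≤ g−2, where σ acts on k^{g−1} coordinatewise. Then the components v_1, v_2, …, v_m are linearly dependent over 𝔽_{p²}. -/
open Finset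

/-- Abel summation for the operator `∑ a, e a • φ ^ a`. -/
theorem sum_mul_iterate_eq_sub {k : Type*} [Field k] (φ : k →+* k) (e : ℕ → k) (x : k)
    (N : ℕ) :
    ∑ a ∈ range (N + 1), e a * φ^[a] x
      = (∑ a ∈ range (N + 1), e a) * φ^[N] x
        - ∑ a ∈ range N, (∑ b ∈ range (a + 1), e b) * φ^[a] (φ x - x) := by
  induction N with
  | zero => simp
  | succ N ih =>
    rw [sum_range_succ, ih, sum_range_succ e (N + 1),
      sum_range_succ (fun a => (∑ b ∈ range (a + 1), e b) * φ^[a] (φ x - x)) N, iterate_map_sub,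
      ← Function.iterate_succ_apply φ N x]
    ring

/-- If `N` elements of a field are annihilated by a nonzero operator `∑ a < N, d a • φ ^ a`, then
they are linearly dependent over the fixed field of `φ`. -/
theorem exists_fixed_relation_of_iterate_relation {k : Type*} [Field k] (φ : k →+* k) (N : ℕ) :
    ∀ d u : ℕ → k, (∃ a < N, d a ≠ 0) →
      (∀ i < N, ∑ a ∈ range N, d a * φ^[a] (u i) = 0) →
      ∃ c : ℕ → k, (∀ i, φ (c i) = c i) ∧ (∃ i < N, c i ≠ 0) ∧ ∑ i ∈ range N, c i * u i = 0 := by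
  induction N with
  | zero => rintro d u ⟨a, ha, -⟩; omega
  | succ N ih =>
    intro d u hd hu
    by_cases h0 : u 0 = 0
    · refine ⟨fun i => if i = 0 then 1 else 0, fun i => ?_, ⟨0, by omega, by simp⟩, ?_⟩
      · dsimp only; split_ifs <;> simp
      · simp [h0]
    let e : ℕ → k := fun a => d a * φ^[a] (u 0)
    set x : ℕ → k := fun i => u (i + 1) / u 0 with hx
    have hx' (i : ℕ) : u (i + 1) = u 0 * x i := by simp only [hx]; field_simp
    have he0 : ∑ a ∈ range (N + 1), e a = 0 := hu 0 (by omega)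
    obtain ⟨c, hc, ⟨i, hi, hci⟩, hs⟩ := ih (fun a => ∑ b ∈ range (a + 1), e b)
      (fun i => φ (x i) - x i) (by
        by_contra! h
        have hz : ∀ a ≤ N + 1, ∑ b ∈ range a, e b = 0 := by
          intro a ha
          rcases a with _ | a
          · simp
          · rcases Nat.lt_or_ge a N with h' | h'
            · exact h a h'
            · rw [show a = N by omega, he0]
        obtain ⟨a, ha, hda⟩ := hd
        have h1 := hz (a + 1) (by omega)
        rw [sum_range_succ, hz a (by omega), zero_add] at h1
        have : φ^[a] (u 0) ≠ 0 := by
          rw [← iterate_map_zero φ a]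
          exact (φ.injective.iterate a).ne h0
        exact (mul_ne_zero hda this) h1) (by
        intro i hi
        have h1 := sum_mul_iterate_eq_sub φ e (x i) N
        rw [he0, zero_mul, zero_sub] at h1
        have h2 := hu (i + 1) (by omega)
        simp only [hx', iterate_map_mul, ← mul_assoc] at h2
        exact neg_eq_zero.mp (h1.symm.trans h2))
    have hfix : φ (∑ i ∈ range N, c i * x i) = ∑ i ∈ range N, c i * x i := by
      rw [← sub_eq_zero, ← hs, map_sum, ← sum_sub_distrib]
      exact sum_congr rfl fun i _ => by rw [map_mul, hc]; ring
    refine ⟨fun j => Nat.casesOn j (-∑ i ∈ range N, c i * x i) c, ?_, ⟨i + 1, by omega, hci⟩, ?_⟩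
    · rintro (_ | j)
      · change φ (-_) = -_
        rw [map_neg, hfix]
      · exact hc j
    · rw [sum_range_succ']
      change _ + -_ * u 0 = 0
      simp only [hx', neg_mul, sum_mul]
      rw [← sub_eq_add_neg, sub_eq_zero]
      exact sum_congr rfl fun i _ => by ring

/-- A vector of length `2 n` which is orthogonal to its first `n` odd Frobenius twists spans, under
the even twists, a space of dimension at most `n`. -/
theorem exists_even_twist_relation {k : Type*} [Field k] [IsAlgClosed k] (p : ℕ) [Fact p.Prime]
    [CharP k p] {ι : Type*} [Fintype ι] (n : ℕ) (hcard : Fintype.card ι = 2 * n) (v : ι → k)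
    (τ : Equiv.Perm ι) (hτ : ∀ i, τ (τ i) = i)
    (hv : ∀ j, Odd j → j < 2 * n → ∑ i, v i * v (τ i) ^ p ^ j = 0) :
    ∃ d : ℕ → k, (∃ a < n + 1, d a ≠ 0) ∧
      ∀ i, ∑ a ∈ range (n + 1), d a * v i ^ p ^ (2 * a) = 0 := by
  have hv' (j : ℕ) (hj : Odd j) (hjn : j < 2 * n) : ∑ i, v i ^ p ^ j * v (τ i) = 0 := by
    rw [← hv j hj hjn, ← Equiv.sum_comp τ]
    exact sum_congr rfl fun i _ => by rw [hτ, mul_comm]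
  have horth (a b : ℕ) (ha : a ≤ n) (hb : b < n) :
      ∑ i, v i ^ p ^ (2 * a) * v (τ i) ^ p ^ (2 * b + 1) = 0 := by
    rcases Nat.lt_or_ge b a with h | h
    · have h1 := congrArg (· ^ p ^ (2 * b + 1)) (hv' (2 * (a - b - 1) + 1) ⟨_, rfl⟩ (by omega))
      simp only [sum_pow_char_pow, mul_pow, ← pow_mul, ← pow_add] at h1
      rw [zero_pow (pow_ne_zero _ (Fact.out : p.Prime).ne_zero)] at h1
      rwa [show 2 * (a - b - 1) + 1 + (2 * b + 1) = 2 * a by omega] at h1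
    · have h1 := congrArg (· ^ p ^ (2 * a)) (hv (2 * (b - a) + 1) ⟨_, rfl⟩ (by omega))
      simp only [sum_pow_char_pow, mul_pow, ← pow_mul, ← pow_add] at h1
      rw [zero_pow (pow_ne_zero _ (Fact.out : p.Prime).ne_zero)] at h1
      rwa [show 2 * (b - a) + 1 + 2 * a = 2 * b + 1 by omega] at h1
  let A : Matrix (Fin (n + 1)) ι k := fun a i => v i ^ p ^ (2 * (a : ℕ))
  let B : Matrix (Fin n) ι k := fun b i => v (τ i) ^ p ^ (2 * (b : ℕ) + 1)
  have hAB : A * B.transpose = 0 := by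
    ext a b
    exact horth a b (by omega) b.2
  have hrank := Matrix.rank_add_rank_le_card_of_mul_eq_zero hAB
  rw [Matrix.rank_transpose, hcard] at hrank
  by_cases hA : LinearIndependent k A
  · have hB : ¬ LinearIndependent k B := by
      intro hB
      have h1 : A.rank = _ := LinearIndependent.rank_matrix hA
      have h2 : B.rank = _ := LinearIndependent.rank_matrix hB
      rw [h1, h2, Fintype.card_fin, Fintype.card_fin] at hrank
      omega
    obtain ⟨f, hf, b, hb⟩ := Fintype.not_linearIndependent_iff.mp hB
    choose r hr using fun b => IsAlgClosed.exists_pow_nat_eq (f b) (Fact.out : p.Prime).pos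
    refine ⟨fun a => if h : a < n then r ⟨a, h⟩ else 0, ⟨b, by omega, ?_⟩, fun i => ?_⟩
    · have : r b ≠ 0 := by
        intro h
        exact hb (by rw [← hr, h, zero_pow (Fact.out : p.Prime).ne_zero])
      simpa using this
    · beta_reduce
      rw [sum_range_succ, dif_neg (lt_irrefl n), zero_mul, add_zero, ← Fin.sum_univ_eq_sum_range
        (fun a => (if h : a < n then r ⟨a, h⟩ else 0) * v i ^ p ^ (2 * a))]
      have h1 := congrFun hf (τ i)
      simp only [Finset.sum_apply, Pi.smul_apply, smul_eq_mul, Pi.zero_apply, B, hτ] at h1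
      refine eq_zero_of_pow_eq_zero (n := p) ?_
      rw [sum_pow_char, ← h1]
      refine sum_congr rfl fun b _ => ?_
      rw [dif_pos b.2, mul_pow, hr, ← pow_mul, ← pow_succ]
  · obtain ⟨f, hf, b, hb⟩ := Fintype.not_linearIndependent_iff.mp hA
    refine ⟨fun a => if h : a < n + 1 then f ⟨a, h⟩ else 0, ⟨b, b.2, ?_⟩, fun i => ?_⟩
    · beta_reduce
      rwa [dif_pos b.2]
    · rw [← Fin.sum_univ_eq_sum_range
          (fun a => (if h : a < n + 1 then f ⟨a, h⟩ else 0) * v i ^ p ^ (2 * a))]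
      have h1 := congrFun hf i
      simp only [Finset.sum_apply, Pi.smul_apply, smul_eq_mul, Pi.zero_apply, A] at h1
      rw [← h1]
      exact sum_congr rfl fun b _ => by rw [dif_pos b.2]

theorem frobeniusEquiv_pow_apply {k : Type*} [Field k] (p : ℕ) [Fact p.Prime] [CharP k p]
    [PerfectRing k p] (j : ℕ) (x : k) :
    ((frobeniusEquiv k p : RingAut k) ^ j) x = x ^ p ^ j := by
  induction j with
  | zero => simp
  | succ j ih =>
    rw [pow_succ', RingAut.mul_apply, ih, frobeniusEquiv_def, ← pow_mul, ← pow_succ]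

theorem iterateFrobenius_iterate_apply {k : Type*} [Field k] (p : ℕ) [Fact p.Prime] [CharP k p]
    (r a : ℕ) (x : k) : (iterateFrobenius k p r)^[a] x = x ^ p ^ (r * a) := by
  induction a with
  | zero => simp
  | succ a ih =>
    rw [Function.iterate_succ_apply', ih, iterateFrobenius_def, ← pow_mul, ← pow_add, mul_add_one]

/-- Let `g ≥ 5` be odd, `m = (g+1)/2`. Define the symmetric bilinear form
on `k^(g−1)` (coordinates indexed `1, …, g−1`) by
`{x, y} = x_1·y_1 + x_m·y_m + ∑_{2 ≤ i ≤ g−1, i ≠ m} x_i·y_{g+1−i}`.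
If `v` satisfies `{v, σ^j(v)} = 0` for every odd `j` with `1 ≤ j ≤ g−2` (σ acting
coordinatewise), then `v_1, …, v_m` are linearly dependent over `𝔽_{p²}`. -/
theorem stmt15 (p : ℕ) [Fact p.Prime] (k : Type*) [Field k] [IsAlgClosed k] [CharP k p]
    (g : ℕ) (hg : 5 ≤ g) (hgodd : Odd g) (v : ℕ → k)
    (hv : ∀ j : ℕ, 1 ≤ j → j ≤ g - 2 → Odd j →
      v 1 * ((frobeniusEquiv k p : RingAut k) ^ j) (v 1)
        + v ((g + 1) / 2) * ((frobeniusEquiv k p : RingAut k) ^ j) (v ((g + 1) / 2))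
        + ∑ i ∈ (Finset.Icc 2 (g - 1)).filter (fun i => i ≠ (g + 1) / 2),
            v i * ((frobeniusEquiv k p : RingAut k) ^ j) (v (g + 1 - i)) = 0) :
    ¬ (∀ c : ℕ → k, (∀ i, c i ^ p ^ 2 = c i) →
        ∑ i ∈ Finset.Icc 1 ((g + 1) / 2), c i * v i = 0 →
        ∀ i ∈ Finset.Icc 1 ((g + 1) / 2), c i = 0) := by
  obtain ⟨n, rfl⟩ := hgodd
  have hm : (2 * n + 1 + 1) / 2 = n + 1 := by omega
  simp only [hm, frobeniusEquiv_pow_apply, Nat.add_sub_cancel] at hv ⊢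
  let f : ℕ → ℕ := fun i => if i = 1 ∨ i = n + 1 then i else 2 * n + 2 - i
  have hfS : ∀ i ∈ Icc 1 (2 * n), f i ∈ Icc 1 (2 * n) := by
    intro i hi
    simp only [mem_Icc, f] at hi ⊢
    split_ifs <;> omega
  have hff : ∀ i ∈ Icc 1 (2 * n), f (f i) = i := by
    intro i hi
    simp only [mem_Icc, f] at hi ⊢
    split_ifs <;> omega
  have hinv : Function.Involutive
      (fun i : Icc 1 (2 * n) => (⟨f i, hfS i i.2⟩ : Icc 1 (2 * n))) :=
    fun i => Subtype.ext (hff i i.2)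
  obtain ⟨d, hd, hrel⟩ := exists_even_twist_relation p (ι := Icc 1 (2 * n)) n (by simp)
    (fun i => v i) hinv.toPerm hinv (by
      intro j hj hjn
      rw [← hv j hj.pos (by omega) hj]
      change ∑ i : Icc 1 (2 * n), v i * v (f i) ^ p ^ j = _
      rw [sum_coe_sort (Icc 1 (2 * n)) (fun i => v i * v (f i) ^ p ^ j)]
      have hS : Icc 1 (2 * n) = insert 1 (insert (n + 1) {i ∈ Icc 2 (2 * n) | i ≠ n + 1}) := by
        ext i
        simp only [mem_Icc, mem_insert, mem_filter]
        omega
      rw [hS, sum_insert (by simp; omega), sum_insert (by simp), ← add_assoc]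
      congr 1
      · simp [f]
      · refine sum_congr rfl fun i hi => ?_
        simp only [mem_filter, mem_Icc] at hi
        simp only [f]
        rw [if_neg (by omega)])
  obtain ⟨c, hc, ⟨i, hi, hci⟩, hs⟩ := exists_fixed_relation_of_iterate_relation
    (iterateFrobenius k p 2) (n + 1) d (fun i => v (i + 1)) hd (by
      intro i hi
      simp only [iterateFrobenius_iterate_apply]
      exact hrel ⟨i + 1, by simp; omega⟩)
  intro h
  refine hci (h (fun i => c (i - 1)) (fun i => hc _) ?_ (i + 1) (by simp; omega))
  rw [← hs, range_eq_Ico]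
  exact (sum_Ico_add' (fun i => c (i - 1) * v i) 0 (n + 1) 1).symm
end

section
/- Let p = 2, let g ≥ 5, and let δ = (δ_{il})_{1≤i,l≤g} be a g×g matrix with entries in 𝔽_4 = 𝔽_{p²} having at least one nonzero off-diagonal entry (δ_{il} ≠ 0 for some i ≠ l). Then there exists a tuple (a_1, …, a_g) ∈ k^g which is linearly independent over 𝔽_{p²} and satisfies the self-duality relations R_g, such that the 4×g matrix over k whose i-th column is (a_i, σ²(a_i), σ⁴(a_i), ∑_{l=1}^g δ_{il}·σ²(a_l))ᵀ has rank 4. -/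
open Finset

/-- The self-duality relations `R_g` on a tuple `(a_1, …, a_g)` (indexed here by `1, …, g`):
for `g` even, `∑_{i=1}^{g/2−1}(−a_{g+1−i}·σ^j(a_i) + σ^j(a_{g+1−i})·a_i)
= −a_{g/2}·σ^j(a_{g/2+1}) + σ^j(a_{g/2})·a_{g/2+1}` for every even `j` with `1 ≤ j < g−1`;
for `g` odd with `m = (g+1)/2`, `∑_{i=1}^{(g−1)/2}(a_{g+1−i}·σ^j(a_i) + σ^j(a_{g+1−i})·a_i)
= (−1)^m·a_m·σ^j(a_m)` for every odd `j` with `1 ≤ j < g−1`. -/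
def SelfDualRelations (p : ℕ) [Fact p.Prime] {k : Type*} [Field k] [IsAlgClosed k] [CharP k p]
    (g : ℕ) (a : ℕ → k) : Prop :=
  if Even g then
    ∀ j : ℕ, 1 ≤ j → j < g - 1 → Even j →
      ∑ i ∈ Finset.Icc 1 (g / 2 - 1),
        (-(a (g + 1 - i)) * ((frobeniusEquiv k p : RingAut k) ^ j) (a i)
          + ((frobeniusEquiv k p : RingAut k) ^ j) (a (g + 1 - i)) * a i)
        = -(a (g / 2)) * ((frobeniusEquiv k p : RingAut k) ^ j) (a (g / 2 + 1))
          + ((frobeniusEquiv k p : RingAut k) ^ j) (a (g / 2)) * a (g / 2 + 1)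
  else
    ∀ j : ℕ, 1 ≤ j → j < g - 1 → Odd j →
      ∑ i ∈ Finset.Icc 1 ((g - 1) / 2),
        (a (g + 1 - i) * ((frobeniusEquiv k p : RingAut k) ^ j) (a i)
          + ((frobeniusEquiv k p : RingAut k) ^ j) (a (g + 1 - i)) * a i)
        = (-1 : k) ^ ((g + 1) / 2) * a ((g + 1) / 2)
          * ((frobeniusEquiv k p : RingAut k) ^ j) (a ((g + 1) / 2))



section HyperbolicForm

variable {k : Type*} [Field k]

/-- The symmetric bilinear form `∑ x_i y_{g-1-i}` on the coordinates `0, …, g-1`. -/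
def hypForm (g : ℕ) (x y : ℕ → k) : k := ∑ i ∈ range g, x i * y (g - 1 - i)

lemma hypForm_comm (g : ℕ) (x y : ℕ → k) : hypForm g x y = hypForm g y x := by
  unfold hypForm
  rw [← sum_range_reflect]
  refine sum_congr rfl fun i hi => ?_
  rw [mem_range] at hi
  rw [show g - 1 - (g - 1 - i) = i by omega, mul_comm]

lemma hypForm_even (n : ℕ) (x y : ℕ → k) :
    hypForm (2 * n) x y
      = ∑ i ∈ range n, (x i * y (2 * n - 1 - i) + x (2 * n - 1 - i) * y i) := by
  unfold hypForm
  rw [sum_add_distrib, two_mul n, sum_range_add]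
  congr 1
  rw [← sum_range_reflect]
  refine sum_congr rfl fun i hi => ?_
  rw [mem_range] at hi
  congr 2 <;> omega

lemma hypForm_odd (n : ℕ) (x y : ℕ → k) :
    hypForm (2 * n + 1) x y
      = ∑ i ∈ range n, (x i * y (2 * n - i) + x (2 * n - i) * y i) + x n * y n := by
  unfold hypForm
  rw [sum_add_distrib, show 2 * n + 1 = (n + 1) + n by omega, sum_range_add, sum_range_succ,
    show n + 1 + n - 1 - n = n by omega, add_right_comm]
  congr 2
  · refine sum_congr rfl fun i hi => ?_
    rw [mem_range] at hi
    congr 2; omega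
  · rw [← sum_range_reflect]
    refine sum_congr rfl fun i hi => ?_
    rw [mem_range] at hi
    congr 2 <;> omega

lemma hypForm_add_single {g l : ℕ} (hl : l < g) (x y : ℕ → k) (s t : k) :
    hypForm g (fun i => x i + s * if i = l then 1 else 0) (fun i => y i + t * if i = l then 1 else 0)
      = hypForm g x y + t * x (g - 1 - l) + s * y (g - 1 - l)
        + s * t * if l = g - 1 - l then 1 else 0 := by
  have h1 : hypForm g x (fun i => if i = l then 1 else 0) = x (g - 1 - l) := by
    unfold hypForm
    rw [sum_eq_single (g - 1 - l)]
    · simp [show g - 1 - (g - 1 - l) = l by omega]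
    · intro b hb hne
      rw [mem_range] at hb
      simp [show g - 1 - b ≠ l by omega]
    · intro h
      exact absurd (mem_range.2 (by omega)) h
  have h2 : hypForm g (fun i => if i = l then 1 else 0) y = y (g - 1 - l) := by
    unfold hypForm
    rw [sum_eq_single l]
    · simp
    · intro b _ hne
      simp [hne]
    · intro h
      exact absurd (mem_range.2 hl) h
  have h3 : hypForm g (fun i => if i = l then (1 : k) else 0) (fun i => if i = l then 1 else 0)
      = if l = g - 1 - l then 1 else 0 := by
    unfold hypForm
    rw [sum_eq_single l]
    · simp [eq_comm]
    · intro b _ hne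
      simp [hne]
    · intro h
      exact absurd (mem_range.2 hl) h
  rw [← h1, ← h2, ← h3]
  unfold hypForm
  simp only [mul_sum, ← sum_add_distrib]
  exact sum_congr rfl fun i _ => by ring

lemma sum_Icc_one_eq_sum_range (m : ℕ) (f : ℕ → k) :
    ∑ i ∈ Icc 1 m, f i = ∑ i ∈ range m, f (i + 1) := by
  rw [range_eq_Ico, sum_Ico_add']
  rfl

variable [CharP k 2]

local notation "φ" => iterateFrobenius k 2

lemma hypForm_self_of_even {g : ℕ} (hg : Even g) (x : ℕ → k) : hypForm g x x = 0 := by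
  obtain ⟨n, rfl⟩ := hg
  rw [← two_mul, hypForm_even]
  refine sum_eq_zero fun i _ => ?_
  rw [mul_comm (x (2 * n - 1 - i))]
  exact CharTwo.add_self_eq_zero _

/-- `x` is orthogonal to its Frobenius twists of exponent `j < g`, `j ≡ g` modulo `2`, but not
to its `g`-th twist. -/
structure IsCoxeterPoint (g : ℕ) (x : ℕ → k) : Prop where
  orth : ∀ j, 1 ≤ j → j < g → j % 2 = g % 2 → hypForm g x (fun i => φ j (x i)) = 0
  ne_zero : hypForm g x (fun i => φ g (x i)) ≠ 0

lemma hypForm_frob (g a d : ℕ) (x : ℕ → k) :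
    hypForm g (fun i => φ a (x i)) (fun i => φ (a + d) (x i))
      = φ a (hypForm g x (fun i => φ d (x i))) := by
  simp [hypForm, iterateFrobenius_add_apply]

namespace IsCoxeterPoint

variable {g : ℕ} {x : ℕ → k}

lemma hypForm_frob_frob (hx : IsCoxeterPoint g x) {a b : ℕ} (hab : (a + b) % 2 = g % 2)
    (h1 : a < b + g) (h2 : b < a + g) :
    hypForm g (fun i => φ a (x i)) (fun i => φ b (x i)) = 0 := by
  wlog h : a ≤ b generalizing a b
  · rw [hypForm_comm]
    exact this (by omega) h2 h1 (by omega)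
  obtain ⟨d, rfl⟩ := Nat.exists_eq_add_of_le h
  rw [hypForm_frob]
  rcases Nat.eq_zero_or_pos d with rfl | hd
  · have : hypForm g x (fun i => φ 0 (x i)) = 0 := by
      simpa using hypForm_self_of_even (Nat.even_iff.2 (by omega)) x
    rw [this, map_zero]
  · rw [hx.orth d hd (by omega) (by omega), map_zero]

lemma coeff_eq_zero (hx : IsCoxeterPoint g x) {c : ℕ → k}
    (hc : ∀ i < g, ∑ j ∈ range g, c j * φ (2 * j) (x i) = 0) : ∀ j < g, c j = 0 := by
  intro j
  induction j using Nat.strong_induction_on with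
  | _ j ih =>
  intro hj
  have key : ∑ l ∈ range g,
      c l * hypForm g (fun i => φ (2 * l) (x i)) (fun i => φ (2 * j + g) (x i)) = 0 := by
    simp only [hypForm, mul_sum]
    rw [sum_comm]
    refine sum_eq_zero fun i hi => ?_
    simp only [← mul_assoc]
    rw [← sum_mul, hc i (mem_range.1 hi), zero_mul]
  rw [sum_eq_single j, hypForm_frob] at key
  · rcases mul_eq_zero.1 key with h | h
    · exact h
    · exact absurd ((map_eq_zero _).1 h) hx.ne_zero
  · intro l hl hne
    rw [mem_range] at hl
    rcases lt_or_gt_of_ne hne with h | h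
    · rw [ih l h hl, zero_mul]
    · rw [hx.hypForm_frob_frob (by omega) (by omega) (by omega), mul_zero]
  · intro h
    exact absurd (mem_range.2 hj) h

lemma coeff_five (hx : IsCoxeterPoint g x) (hg : 5 ≤ g) {c₀ c₁ c₂ c₃ c₄ : k}
    (hc : ∀ i < g, c₀ * x i + c₁ * φ 2 (x i) + c₂ * φ 4 (x i) + c₃ * φ 6 (x i)
      + c₄ * φ 8 (x i) = 0) :
    c₀ = 0 ∧ c₁ = 0 ∧ c₂ = 0 ∧ c₃ = 0 ∧ c₄ = 0 := by
  obtain ⟨m, rfl⟩ := Nat.exists_eq_add_of_le hg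
  let c : ℕ → k := fun j => match j with
    | 0 => c₀ | 1 => c₁ | 2 => c₂ | 3 => c₃ | 4 => c₄ | _ => 0
  have h := hx.coeff_eq_zero (c := c) fun i hi => by
    rw [sum_range_add]
    have : ∑ l ∈ range m, c (5 + l) * φ (2 * (5 + l)) (x i) = 0 :=
      sum_eq_zero fun l _ => by simp [c, add_comm 5 l]
    rw [this, add_zero, ← hc i hi]
    simp [sum_range_succ, c]
  exact ⟨h 0 (by omega), h 1 (by omega), h 2 (by omega), h 3 (by omega), h 4 (by omega)⟩

lemma rational_independent (hx : IsCoxeterPoint g x) {c : ℕ → k} (hc : ∀ i, φ 2 (c i) = c i)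
    (h : ∑ i ∈ range g, c i * x i = 0) : ∀ i < g, c i = 0 := by
  let M : Matrix (Fin g) (Fin g) k := Matrix.of fun j i => φ (2 * j) (x i)
  have hM : M.det ≠ 0 := by
    rw [Ne, ← Matrix.exists_vecMul_eq_zero_iff]
    rintro ⟨v, hv, hvM⟩
    refine hv (funext fun j => ?_)
    have := hx.coeff_eq_zero (c := fun j => if hj : j < g then v ⟨j, hj⟩ else 0)
      (fun i hi => by
        have := congrFun hvM ⟨i, hi⟩
        simpa [Matrix.vecMul, dotProduct, M, sum_range] using this) j j.2
    simpa using this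
  have hc' : ∀ j i, φ (2 * j) (c i) = c i := by
    intro j i
    induction j with
    | zero => simp
    | succ j ih => rw [mul_add, mul_one, iterateFrobenius_add_apply, hc, ih]
  have hMc : M.mulVec (fun i => c i) = 0 := by
    ext j
    have := congrArg (φ (2 * j)) h
    simp only [map_sum, map_mul, hc', map_zero, sum_range] at this
    simpa [Matrix.mulVec, dotProduct, M, mul_comm] using this
  intro i hi
  exact congrFun (Matrix.eq_zero_of_mulVec_eq_zero hM hMc) ⟨i, hi⟩

lemma ne_zero_apply (hx : IsCoxeterPoint g x) {i : ℕ} (hi : i < g) : x i ≠ 0 := by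
  intro h
  have := hx.rational_independent (c := fun l => if l = i then 1 else 0)
    (fun l => by split_ifs <;> simp) (by simp [h]) i hi
  simp at this

/-- The span of `x`, `σ²(x)`, `σ⁴(x)` contains no nonzero vector of a rational plane. -/
lemma rational_plane (hx : IsCoxeterPoint g x) (hg : 5 ≤ g) {u v : ℕ → k}
    (hu : ∀ i, φ 2 (u i) = u i) (hv : ∀ i, φ 2 (v i) = v i) {q α β γ : k}
    (h : ∀ i < g, v i + q * u i = α * x i + β * φ 2 (x i) + γ * φ 4 (x i)) :
    α = 0 ∧ β = 0 ∧ γ = 0 := by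
  have h' : ∀ i < g, v i + φ 2 q * u i
      = φ 2 α * φ 2 (x i) + φ 2 β * φ 4 (x i) + φ 2 γ * φ 6 (x i) := fun i hi => by
    have := congrArg (φ 2) (h i hi)
    simpa only [map_add, map_mul, hu, hv, ← iterateFrobenius_add_apply] using this
  have h'' : ∀ i < g, v i + φ 4 q * u i
      = φ 4 α * φ 4 (x i) + φ 4 β * φ 6 (x i) + φ 4 γ * φ 8 (x i) := fun i hi => by
    have := congrArg (φ 2) (h' i hi)
    simpa only [map_add, map_mul, hu, hv, ← iterateFrobenius_add_apply] using this
  by_cases hq : φ 2 q = q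
  · obtain ⟨h0, h1, h2, -, -⟩ := hx.coeff_five hg (c₀ := α) (c₁ := β - φ 2 α)
      (c₂ := γ - φ 2 β) (c₃ := - φ 2 γ) (c₄ := 0) fun i hi => by
        have e := h' i hi
        rw [hq] at e
        linear_combination e - h i hi
    subst h0
    rw [map_zero, sub_zero] at h1
    subst h1
    rw [map_zero, sub_zero] at h2
    exact ⟨rfl, rfl, h2⟩
  · have hd : q - φ 2 q ≠ 0 := fun e => hq (sub_eq_zero.1 e).symm
    have hd' : φ 2 q - φ 4 q ≠ 0 := by
      have : φ 2 (q - φ 2 q) ≠ 0 := (map_ne_zero _).2 hd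
      rwa [map_sub, ← iterateFrobenius_add_apply] at this
    set d := q - φ 2 q
    set d' := φ 2 q - φ 4 q
    obtain ⟨h0, h1, -, -, h4⟩ := hx.coeff_five hg (c₀ := d' * α)
      (c₁ := d' * (β - φ 2 α) - d * φ 2 α)
      (c₂ := d' * (γ - φ 2 β) - d * (φ 2 β - φ 4 α))
      (c₃ := - d' * φ 2 γ - d * (φ 2 γ - φ 4 β)) (c₄ := d * φ 4 γ) fun i hi => by
        linear_combination d' * (h' i hi - h i hi) - d * (h'' i hi - h' i hi)
    have hα : α = 0 := (mul_eq_zero.1 h0).resolve_left hd'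
    subst hα
    refine ⟨rfl, ?_, ?_⟩
    · simpa [hd'] using h1
    · exact (map_eq_zero _).1 ((mul_eq_zero.1 h4).resolve_left hd)

end IsCoxeterPoint

lemma frob_mul_of_fixed {d : ℕ} {y : k} (h : φ d y = y) (m : ℕ) : φ (d * m) y = y := by
  induction m with
  | zero => simp
  | succ m ih => rw [mul_add, mul_one, iterateFrobenius_add_apply, h, ih]

lemma sum_mul_frob {n j j' m : ℕ} {e : ℕ → k} (he : ∀ i, φ (2 * n) (e i) = e i)
    (hj : j + j' = 2 * n * m) (f : ℕ → k) :
    ∑ i ∈ range n, e i * φ j (f i) = φ j (∑ i ∈ range n, φ j' (e i) * f i) := by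
  simp only [map_sum, map_mul, ← iterateFrobenius_add_apply, hj]
  exact sum_congr rfl fun i _ => by rw [frob_mul_of_fixed (he i)]

variable [IsAlgClosed k]

lemma exists_add_frob_eq {n : ℕ} (hn : 1 ≤ n) (c : k) : ∃ y : k, y + φ n y = c := by
  have h1 : 1 < 2 ^ n := Nat.one_lt_two_pow (by omega)
  obtain ⟨y, hy⟩ := IsAlgClosed.exists_root
    (Polynomial.X ^ 2 ^ n + (Polynomial.X - Polynomial.C c)) (by
      rw [Polynomial.degree_add_eq_left_of_degree_lt, Polynomial.degree_X_pow]
      · simp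
      · rw [Polynomial.degree_X_pow, Polynomial.degree_X_sub_C]
        exact_mod_cast h1)
  refine ⟨y, ?_⟩
  simp only [Polynomial.IsRoot.def, Polynomial.eval_sub, Polynomial.eval_add,
    Polynomial.eval_pow, Polynomial.eval_X, Polynomial.eval_C] at hy
  rw [iterateFrobenius_def]
  linear_combination hy

/-- A primitive cube root of unity `c`: it is the parameter of a unitary quasi-reflection along a
vector of norm `1`. -/
lemma exists_cube_root : ∃ c : k, c ≠ 0 ∧ ∀ j, j % 2 = 1 → c + φ j c + c * φ j c = 0 := by
  obtain ⟨ω, hω⟩ := exists_add_frob_eq (k := k) (n := 1) le_rfl 1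
  rw [iterateFrobenius_def, pow_one] at hω
  have h2 : φ 2 ω = ω := by
    rw [iterateFrobenius_def]
    linear_combination (ω ^ 2 - ω) * hω + (ω ^ 2 - ω) * CharTwo.two_eq_zero (R := k)
  refine ⟨ω, ?_, fun j hj => ?_⟩
  · rintro rfl
    simp at hω
  · obtain ⟨m, rfl⟩ : ∃ m, j = 2 * m + 1 := ⟨j / 2, by omega⟩
    rw [add_comm (2 * m), iterateFrobenius_add_apply, frob_mul_of_fixed h2, iterateFrobenius_def,
      pow_one]
    linear_combination ω * hω + ω * CharTwo.two_eq_zero (R := k)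

lemma IsCoxeterPoint.exists_transvection {g : ℕ} {x : ℕ → k} (hx : IsCoxeterPoint g x) {l : ℕ}
    (hl : l < g) : ∃ c : k, c ≠ 0 ∧ IsCoxeterPoint g (fun i => x i + c * if i = l then 1 else 0) := by
  obtain ⟨c, hc0, hc⟩ : ∃ c : k, c ≠ 0 ∧ ∀ j, j % 2 = g % 2 →
      c + φ j c + c * φ j c * (if l = g - 1 - l then 1 else 0) = 0 := by
    by_cases h : l = g - 1 - l
    · obtain ⟨c, hc0, hc⟩ := exists_cube_root (k := k)
      refine ⟨c, hc0, fun j hj => ?_⟩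
      rw [if_pos h, mul_one]
      exact hc j (by omega)
    · exact ⟨1, one_ne_zero, fun j _ => by simp [h, CharTwo.add_self_eq_zero]⟩
  have inv : ∀ j, j % 2 = g % 2 →
      hypForm g (fun i => x i + c * x (g - 1 - l) * if i = l then 1 else 0)
        (fun i => φ j (x i + c * x (g - 1 - l) * if i = l then 1 else 0))
      = hypForm g x (fun i => φ j (x i)) := by
    intro j hj
    have : (fun i => φ j (x i + c * x (g - 1 - l) * if i = l then 1 else 0))
        = fun i => φ j (x i) + φ j c * φ j (x (g - 1 - l)) * if i = l then 1 else 0 := by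
      funext i
      split_ifs <;> simp
    rw [this, hypForm_add_single hl]
    linear_combination (x (g - 1 - l) * φ j (x (g - 1 - l))) * hc j hj
  refine ⟨c * x (g - 1 - l), mul_ne_zero hc0 (hx.ne_zero_apply (by omega)), ⟨fun j h1 h2 h3 => ?_, ?_⟩⟩
  · rw [inv j h3]
    exact hx.orth j h1 h2 h3
  · rw [inv g rfl]
    exact hx.ne_zero

/-- If `δ` has a nonzero off-diagonal entry, a transvection moves `x` to a point at which
`δ σ²(x)` leaves the span of `x`, `σ²(x)`, `σ⁴(x)`. -/
lemma IsCoxeterPoint.exists_notMem_span {g : ℕ} {x : ℕ → k} (hx : IsCoxeterPoint g x) (hg : 5 ≤ g)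
    {δ : ℕ → ℕ → k} (hδ : ∀ i l, φ 2 (δ i l) = δ i l) {i₀ l₀ : ℕ} (hi : i₀ < g) (hl : l₀ < g)
    (hil : i₀ ≠ l₀) (hne : δ i₀ l₀ ≠ 0) :
    ∃ y : ℕ → k, IsCoxeterPoint g y ∧ ∀ α β γ : k, ¬ ∀ i < g,
      ∑ l ∈ range g, δ i l * φ 2 (y l) = α * y i + β * φ 2 (y i) + γ * φ 4 (y i) := by
  by_contra! H
  obtain ⟨c, hc, hy⟩ := hx.exists_transvection hl
  obtain ⟨α, β, γ, h1⟩ := H _ hx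
  obtain ⟨α', β', γ', h2⟩ := H _ hy
  have hc2 : φ 2 c ≠ 0 := (map_ne_zero _).2 hc
  have hsum : ∀ i, ∑ l ∈ range g, δ i l * φ 2 (x l + c * if l = l₀ then 1 else 0)
      = ∑ l ∈ range g, δ i l * φ 2 (x l) + φ 2 c * δ i l₀ := by
    intro i
    simp only [map_add, map_mul, mul_add, sum_add_distrib]
    congr 1
    rw [sum_eq_single l₀]
    · simp [mul_comm]
    · intro b _ hb
      simp [hb]
    · intro h
      exact absurd (mem_range.2 hl) h
  have hu : ∀ (j i : ℕ), φ j (if i = l₀ then (1 : k) else 0) = if i = l₀ then 1 else 0 := by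
    intro j i
    split_ifs <;> simp
  have key : ∀ i < g, δ i l₀
      + (φ 2 c)⁻¹ * (-(α' * c + β' * φ 2 c + γ' * φ 4 c)) * (if i = l₀ then 1 else 0)
      = (φ 2 c)⁻¹ * (α' - α) * x i + (φ 2 c)⁻¹ * (β' - β) * φ 2 (x i)
        + (φ 2 c)⁻¹ * (γ' - γ) * φ 4 (x i) := by
    intro i hi
    have e1 := h1 i hi
    have e2 := h2 i hi
    rw [hsum] at e2
    simp only [map_add, map_mul, hu] at e2
    have e3 := inv_mul_cancel₀ hc2
    linear_combination (φ 2 c)⁻¹ * (e2 - e1) - δ i l₀ * e3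
  obtain ⟨h3, h4, h5⟩ := hx.rational_plane hg (fun i => hu 2 i) (fun i => hδ i l₀) key
  have := key i₀ hi
  rw [h3, h4, h5] at this
  simp [hil, hne] at this

/-- Dual systems: `ζ` of order `4ⁿ - 1` gives an invertible Vandermonde matrix. -/
lemma exists_dual_system {n : ℕ} (hn : 1 ≤ n) {ε : ℕ} (hε : ε ≤ 1) (ψ : ℕ → k) :
    ∃ e f : ℕ → k, (∀ i, φ (2 * n) (e i) = e i) ∧
      ∀ s < n, ∑ i ∈ range n, φ (2 * s + ε) (e i) * f i = ψ s := by
  have h4 : 2 ^ (2 * n) = 2 * 2 ^ (2 * n - 1) := by rw [← pow_succ']; congr 1; omega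
  have h5 : 2 ≤ 2 ^ (2 * n - 1) := by
    calc 2 = 2 ^ 1 := rfl
      _ ≤ _ := Nat.pow_le_pow_right (by norm_num) (by omega)
  have : NeZero ((2 ^ (2 * n) - 1 : ℕ) : k) := ⟨by
    rw [Nat.cast_sub (by omega)]
    have : (2 : k) = 0 := CharTwo.two_eq_zero
    simp [this, show n ≠ 0 by omega]⟩
  have : NeZero (2 ^ (2 * n) - 1) := NeZero.of_neZero_natCast k
  obtain ⟨ζ, hζ⟩ := HasEnoughRootsOfUnity.exists_primitiveRoot k (2 ^ (2 * n) - 1)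
  let v : Fin n → k := fun s => ζ ^ 2 ^ (2 * (s : ℕ) + ε)
  have hv : Function.Injective v := by
    intro s t hst
    have hlt : ∀ s : Fin n, 2 ^ (2 * (s : ℕ) + ε) < 2 ^ (2 * n) - 1 := fun s => by
      have : 2 ^ (2 * (s : ℕ) + ε) ≤ 2 ^ (2 * n - 1) :=
        Nat.pow_le_pow_right (by norm_num) (by omega)
      omega
    have := Nat.pow_right_injective le_rfl (hζ.pow_inj (hlt s) (hlt t) hst)
    exact Fin.ext (by simp at this; omega)
  have hV : IsUnit (Matrix.vandermonde v) := by
    rw [Matrix.isUnit_iff_isUnit_det, isUnit_iff_ne_zero]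
    exact Matrix.det_vandermonde_ne_zero_iff.2 hv
  obtain ⟨w, hw⟩ := Matrix.mulVec_surjective_iff_isUnit.2 hV fun s => ψ s
  refine ⟨fun i => ζ ^ i, fun i => if hi : i < n then w ⟨i, hi⟩ else 0, fun i => ?_, fun s hs => ?_⟩
  · have : φ (2 * n) ζ = ζ := by
      rw [iterateFrobenius_def, show 2 ^ (2 * n) = (2 ^ (2 * n) - 1) + 1 by omega, pow_succ,
        hζ.pow_eq_one, one_mul]
    rw [map_pow, this]
  · have := congrFun hw ⟨s, hs⟩
    simp only [Matrix.mulVec, dotProduct, Matrix.vandermonde_apply, v] at this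
    simpa [sum_range, iterateFrobenius_def, ← pow_mul, mul_comm] using this

lemma exists_isCoxeterPoint_even {n : ℕ} (hn : 1 ≤ n) :
    ∃ x : ℕ → k, IsCoxeterPoint (2 * n) x := by
  obtain ⟨t, ht⟩ := exists_add_frob_eq (k := k) (n := 2 * n) (by omega) 1
  obtain ⟨e, f, he, hef⟩ := exists_dual_system hn (Nat.zero_le 1) fun s => if s = 0 then t else 0
  simp only [add_zero] at hef
  obtain ⟨x, form⟩ : ∃ x : ℕ → k, ∀ j, hypForm (2 * n) x (fun i => φ j (x i))
      = ∑ i ∈ range n, e i * φ j (f i) + ∑ i ∈ range n, φ j (e i) * f i := by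
    refine ⟨fun i => if i < n then e i else f (2 * n - 1 - i), fun j => ?_⟩
    rw [hypForm_even, ← sum_add_distrib]
    refine sum_congr rfl fun i hi => ?_
    rw [mem_range] at hi
    simp only [if_pos hi, if_neg (show ¬ 2 * n - 1 - i < n by omega),
      show 2 * n - 1 - (2 * n - 1 - i) = i by omega]
    ring
  refine ⟨x, ⟨fun j h1 h2 h3 => ?_, ?_⟩⟩
  · obtain ⟨s, rfl⟩ : ∃ s, j = 2 * s := ⟨j / 2, by omega⟩
    rw [form, sum_mul_frob he (j' := 2 * (n - s)) (m := 1) (by omega), hef s (by omega),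
      hef (n - s) (by omega), if_neg (by omega), if_neg (by omega)]
    simp
  · have h0 := hef 0 (by omega)
    rw [if_pos rfl, mul_zero] at h0
    rw [form, sum_mul_frob he (j' := 0) (m := 1) (by omega), h0]
    simp only [he]
    simp only [iterateFrobenius_zero, RingHom.id_apply] at h0
    rw [h0, add_comm, ht]
    exact one_ne_zero

lemma exists_reciprocal_system {n : ℕ} {z : k} :
    ∃ ψ : ℕ → k, ∀ s < n,
      ψ s + φ (2 * s + 1) (ψ (n - 1 - s)) = z * φ (2 * s + 1) z := by
  choose! r hr using fun (d : ℕ) (hd : 1 ≤ d) (c : k) => exists_add_frob_eq hd c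
  let θ : ℕ → k := fun s => if 2 * s + 1 = n then r n (z * φ n z)
    else r (2 * n) ((z + φ (2 * n) z) * φ (2 * s + 1) z)
  refine ⟨fun s => if 2 * s + 1 ≤ n then θ s
    else z * φ (2 * s + 1) z + φ (2 * s + 1) (θ (n - 1 - s)), fun s hs => ?_⟩
  rcases lt_trichotomy (2 * s + 1) n with h | h | h
  · have e : φ (2 * s + 1) (φ (2 * (n - 1 - s) + 1) z) = φ (2 * n) z := by
      rw [← iterateFrobenius_add_apply]; congr 2; omega
    have e' : φ (2 * s + 1) (φ (2 * (n - 1 - s) + 1) (θ s)) = φ (2 * n) (θ s) := by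
      rw [← iterateFrobenius_add_apply]; congr 2; omega
    have hθ : θ s + φ (2 * n) (θ s) = (z + φ (2 * n) z) * φ (2 * s + 1) z := by
      simp only [θ, if_neg h.ne]
      exact hr _ (by omega) _
    simp only [if_pos h.le, if_neg (show ¬ 2 * (n - 1 - s) + 1 ≤ n by omega), map_add, map_mul,
      show n - 1 - (n - 1 - s) = s by omega, e, e']
    linear_combination hθ + φ (2 * n) z * φ (2 * s + 1) z * CharTwo.two_eq_zero (R := k)
  · simp only [show n - 1 - s = s by omega, if_pos h.le, θ, if_pos h]
    rw [h]
    exact hr _ (by omega) _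
  · simp only [if_neg h.not_ge, if_pos (show 2 * (n - 1 - s) + 1 ≤ n by omega)]
    linear_combination φ (2 * s + 1) (θ (n - 1 - s)) * CharTwo.two_eq_zero (R := k)

lemma exists_isCoxeterPoint_odd {n : ℕ} (hn : 1 ≤ n) :
    ∃ x : ℕ → k, IsCoxeterPoint (2 * n + 1) x := by
  obtain ⟨z, hz⟩ := exists_add_frob_eq (k := k) (n := 2 * n) (by omega) 1
  obtain ⟨ψ, hψ⟩ := exists_reciprocal_system (n := n) (z := z)
  obtain ⟨e, f, he, hef⟩ := exists_dual_system hn le_rfl ψ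
  obtain ⟨x, form⟩ : ∃ x : ℕ → k, ∀ j, hypForm (2 * n + 1) x (fun i => φ j (x i))
      = ∑ i ∈ range n, e i * φ j (f i) + ∑ i ∈ range n, φ j (e i) * f i + z * φ j z := by
    refine ⟨fun i => if i < n then e i else if i = n then z else f (2 * n - i), fun j => ?_⟩
    rw [hypForm_odd, ← sum_add_distrib]
    congr 1
    · refine sum_congr rfl fun i hi => ?_
      rw [mem_range] at hi
      simp only [if_pos hi, if_neg (show ¬ 2 * n - i < n by omega),
        if_neg (show ¬ 2 * n - i = n by omega), show 2 * n - (2 * n - i) = i by omega]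
      ring
    · simp
  have two : (2 : k) = 0 := CharTwo.two_eq_zero
  refine ⟨x, ⟨fun j h1 h2 h3 => ?_, ?_⟩⟩
  · obtain ⟨s, rfl⟩ : ∃ s, j = 2 * s + 1 := ⟨j / 2, by omega⟩
    rw [form, sum_mul_frob he (j' := 2 * (n - 1 - s) + 1) (m := 1) (by omega), hef s (by omega),
      hef (n - 1 - s) (by omega)]
    linear_combination hψ s (by omega) + z * φ (2 * s + 1) z * two
  · have h0 := hef 0 (by omega)
    rw [form, sum_mul_frob he (j' := 2 * (n - 1) + 1) (m := 2) (by omega),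
      hef (n - 1) (by omega)]
    simp only [add_comm (2 * n) 1, iterateFrobenius_add_apply, he]
    have e1 := congrArg (φ (2 * n)) (hψ 0 (by omega))
    have e2 := congrArg (φ 1) (hψ (n - 1) (by omega))
    have e3 := hψ 0 (by omega)
    have e4 := congrArg (φ 1) hz
    simp only [mul_zero, zero_add, map_add, map_mul, map_one, ← iterateFrobenius_add_apply,
      show 1 + (2 * (n - 1) + 1) = 2 * n by omega, Nat.sub_self, Nat.sub_zero,
      add_comm (2 * n) 1] at h0 e1 e2 e3 e4 ⊢
    rw [h0]
    refine ne_of_eq_of_ne (b := 1) ?_ one_ne_zero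
    linear_combination e1 + e2 + e3 + (z + φ (2 * n) z) * e4 + hz
      - (φ 1 (ψ (n - 1)) + φ (2 * n) (ψ 0)) * two

lemma exists_isCoxeterPoint {g : ℕ} (hg : 2 ≤ g) : ∃ x : ℕ → k, IsCoxeterPoint g x := by
  obtain ⟨n, rfl | rfl⟩ := g.even_or_odd'
  · exact exists_isCoxeterPoint_even (by omega)
  · exact exists_isCoxeterPoint_odd (by omega)

lemma frobeniusEquiv_pow_apply_s17 (j : ℕ) (y : k) :
    ((frobeniusEquiv k 2 : RingAut k) ^ j) y = φ j y := by
  induction j with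
  | zero => simp
  | succ j ih =>
    rw [pow_succ', RingAut.mul_apply, ih, frobeniusEquiv_def, iterateFrobenius_def,
      iterateFrobenius_def, pow_succ 2 j, pow_mul]

lemma IsCoxeterPoint.selfDualRelations {g : ℕ} (hg : 2 ≤ g) {x : ℕ → k}
    (hx : IsCoxeterPoint g x) : SelfDualRelations 2 g (fun n => x (n - 1)) := by
  unfold SelfDualRelations
  simp only [frobeniusEquiv_pow_apply_s17, CharTwo.neg_eq, one_pow, one_mul]
  split_ifs with h
  · intro j h1 h2 h3
    obtain ⟨m, rfl⟩ : ∃ m, g = 2 * (m + 1) := ⟨g / 2 - 1, by grind⟩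
    have := hx.orth j h1 (by omega) (by grind)
    rw [hypForm_even, sum_range_succ, CharTwo.add_eq_zero] at this
    rw [sum_Icc_one_eq_sum_range, show 2 * (m + 1) / 2 = m + 1 by omega, Nat.add_sub_cancel]
    simp only [show 2 * (m + 1) - 1 - m = m + 1 by omega] at this
    simp only [Nat.add_sub_cancel]
    refine (sum_congr rfl fun i hi => ?_).trans (this.trans (by ring))
    rw [show 2 * (m + 1) + 1 - (i + 1) - 1 = 2 * (m + 1) - 1 - i by omega]
    ring
  · intro j h1 h2 h3
    obtain ⟨m, rfl⟩ : ∃ m, g = 2 * m + 1 := ⟨g / 2, by grind⟩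
    have := hx.orth j h1 (by omega) (by grind)
    rw [hypForm_odd, CharTwo.add_eq_zero] at this
    rw [sum_Icc_one_eq_sum_range, show (2 * m + 1 + 1) / 2 = m + 1 by omega,
      show (2 * m + 1 - 1) / 2 = m by omega, Nat.add_sub_cancel, ← this]
    refine sum_congr rfl fun i hi => ?_
    rw [Nat.add_sub_cancel, show 2 * m + 1 + 1 - (i + 1) - 1 = 2 * m - i by omega]
    ring

end HyperbolicForm

/-- Let `p = 2`, `g ≥ 5`, and `δ = (δ_il)` a `g×g` matrix with entries in
`𝔽_4 = 𝔽_{p²}` having a nonzero off-diagonal entry. Then there is a tuple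
`(a_1, …, a_g) ∈ k^g`, linearly independent over `𝔽_{p²}` and satisfying the
self-duality relations `R_g`, such that the `4×g` matrix whose `i`-th column is
`(a_i, σ²(a_i), σ⁴(a_i), ∑_l δ_il·σ²(a_l))ᵀ` has rank 4. -/
theorem stmt17 (p : ℕ) [Fact p.Prime] (hp : p = 2)
    (k : Type*) [Field k] [IsAlgClosed k] [CharP k p]
    (g : ℕ) (hg : 5 ≤ g) (δ : ℕ → ℕ → k)
    (hδF : ∀ i l, δ i l ^ p ^ 2 = δ i l)
    (hδne : ∃ i ∈ Finset.Icc 1 g, ∃ l ∈ Finset.Icc 1 g, i ≠ l ∧ δ i l ≠ 0) :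
    ∃ a : ℕ → k,
      (∀ c : ℕ → k, (∀ i, c i ^ p ^ 2 = c i) →
        ∑ i ∈ Finset.Icc 1 g, c i * a i = 0 → ∀ i ∈ Finset.Icc 1 g, c i = 0) ∧
      SelfDualRelations p g a ∧
      (Matrix.of fun (r : Fin 4) (j : Fin g) =>
          ![a ((j : ℕ) + 1),
            ((frobeniusEquiv k p : RingAut k) ^ 2) (a ((j : ℕ) + 1)),
            ((frobeniusEquiv k p : RingAut k) ^ 4) (a ((j : ℕ) + 1)),
            ∑ l ∈ Finset.Icc 1 g, δ ((j : ℕ) + 1) l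
              * ((frobeniusEquiv k p : RingAut k) ^ 2) (a l)] r).rank
        = 4 := by
  subst hp
  simp only [← iterateFrobenius_def] at hδF
  obtain ⟨i₀, hi₀, l₀, hl₀, hil, hne⟩ := hδne
  rw [mem_Icc] at hi₀ hl₀
  obtain ⟨x₀, hx₀⟩ := exists_isCoxeterPoint (k := k) (g := g) (by omega)
  obtain ⟨x, hx, hspan⟩ := hx₀.exists_notMem_span hg (δ := fun i l => δ (i + 1) (l + 1))
    (fun i l => hδF _ _) (i₀ := i₀ - 1) (l₀ := l₀ - 1) (by omega) (by omega) (by omega)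
    (by simpa [Nat.sub_add_cancel hi₀.1, Nat.sub_add_cancel hl₀.1] using hne)
  refine ⟨fun n => x (n - 1), fun c hc h i hi => ?_, hx.selfDualRelations (by omega), ?_⟩
  · rw [mem_Icc] at hi
    simp only [← iterateFrobenius_def] at hc
    rw [sum_Icc_one_eq_sum_range] at h
    have := hx.rational_independent (c := fun i => c (i + 1)) (fun i => hc _) h (i - 1) (by omega)
    rwa [Nat.sub_add_cancel hi.1] at this
  · simp only [frobeniusEquiv_pow_apply_s17, sum_Icc_one_eq_sum_range, Nat.add_sub_cancel]
    rw [LinearIndependent.rank_matrix, Fintype.card_fin]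
    rw [Fintype.linearIndependent_iff]
    intro c hc
    have hc' : ∀ i < g, c 0 * x i + c 1 * iterateFrobenius k 2 2 (x i)
        + c 2 * iterateFrobenius k 2 4 (x i)
        + c 3 * ∑ l ∈ range g, δ (i + 1) (l + 1) * iterateFrobenius k 2 2 (x l) = 0 := by
      intro i hi
      simpa [Fin.sum_univ_four] using congrFun hc ⟨i, hi⟩
    have h3 : c 3 = 0 := by
      by_contra h3
      refine hspan (-c 0 / c 3) (-c 1 / c 3) (-c 2 / c 3) fun i hi => ?_
      field_simp
      linear_combination hc' i hi
    obtain ⟨h0, h1, h2, -, -⟩ := hx.coeff_five hg (c₀ := c 0) (c₁ := c 1) (c₂ := c 2) (c₃ := 0)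
      (c₄ := 0) fun i hi => by simpa [h3] using hc' i hi
    intro r
    fin_cases r
    exacts [h0, h1, h2, h3]
end
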